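/- arXiv:0707.1313 — 2 statements merged into one kernel-verified Lean document; each statement's English description precedes it below -/
import Mathlib

section
/- Consider the Polish space 𝔾 (a G_δ subspace of Baire space) and the set A := {(γ_i)_{i∈ℕ} ∈ 𝔸_ω : γ_i ∈ 𝔾 for all i}. Then neither of the following holds: (a) there is a Borel map c : 𝔾 → ℕ such that for every (γ_i)_{i∈ℕ} ∈ A the values c(γ_i) are not all equal; (b) there is a continuous map u : ω^ω → 𝔾 such that for every (γ_i)_{i∈ℕ} ∈ 𝔸_ω, the sequence (u(γ_i))_{i∈ℕ} belongs to A. In particular, the dichotomy of the finite-dimensional Kechris–Solecki–Todorčević theorem, with (ω^ω, 𝔸_ω) in place of (d^ω, 𝔸_d) and continuous homomorphisms in (b), fails in dimension ω. -/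
open Set

/-- Concatenation `s ⌢ γ` of a finite sequence with an infinite sequence. -/
def cat {α : Type*} (s : List α) (γ : ℕ → α) : ℕ → α :=
  fun k => if h : k < s.length then s.get ⟨k, h⟩ else γ (k - s.length)

/-- The finite sequence `t` is an initial segment of the infinite sequence `f`. -/
def IsPrefixFun {α : Type*} (t : List α) (f : ℕ → α) : Prop :=
  ∀ k, (h : k < t.length) → f k = t.get ⟨k, h⟩

/-- The set `𝔸_ω ⊆ (ω^ω)^ω` associated with the dense sequence `s`. -/
def Aomega (s : ℕ → List ℕ) : Set (ℕ → ℕ → ℕ) :=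
  {x | ∃ n γ, ∀ i, x i = cat (s n ++ [i]) γ}

/-- The set `𝔾 ⊆ ω^ω` associated with the dense sequence `s`. -/
def Gset (s : ℕ → List ℕ) : Set (ℕ → ℕ) :=
  {α | ∀ m, ∃ n ≥ m, IsPrefixFun (s n ++ [0]) α}

open Function Filter Topology

theorem IsPrefixFun.of_isPrefix {α : Type*} {t r : List α} {f : ℕ → α} (h : t <+: r)
    (hf : IsPrefixFun r f) : IsPrefixFun t f := fun k hk => by
  rw [hf k (hk.trans_le h.length_le)]
  simpa using (h.getElem hk).symm

theorem isPrefixFun_cat {α : Type*} (t : List α) (γ : ℕ → α) : IsPrefixFun t (cat t γ) :=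
  fun k hk => by simp [cat, hk]

theorem cat_add_length {α : Type*} (t : List α) (γ : ℕ → α) (k : ℕ) :
    cat t γ (k + t.length) = γ k := by
  simp [cat]

theorem IsPrefixFun.cat_shift {α : Type*} {t : List α} {f : ℕ → α} (h : IsPrefixFun t f) :
    cat t (fun k => f (k + t.length)) = f := by
  ext k
  by_cases hk : k < t.length
  · simp [cat, hk, h k hk]
  · simp [cat, hk, Nat.sub_add_cancel (not_lt.1 hk)]

theorem cat_concat_eq_update {α : Type*} (t : List α) (a b : α) (γ : ℕ → α) :
    cat (t ++ [a]) γ = update (cat (t ++ [b]) γ) t.length a := by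
  ext k
  rcases lt_trichotomy k t.length with hk | rfl | hk
  · simp [cat, update_of_ne hk.ne, hk, Nat.lt_succ_of_lt hk, List.getElem_append_left]
  · simp [cat]
  · simp [cat, update_of_ne hk.ne', not_lt.2 (Nat.succ_le_of_lt hk)]

theorem isPrefixFun_concat {α : Type*} {t : List α} {a : α} {f : ℕ → α} :
    IsPrefixFun (t ++ [a]) f ↔ IsPrefixFun t f ∧ f t.length = a := by
  constructor
  · exact fun h => ⟨h.of_isPrefix (List.prefix_append _ _), by
      simpa using h t.length (by simp)⟩
  · rintro ⟨h, rfl⟩ k hk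
    rcases (Nat.lt_succ_iff_lt_or_eq.1 (by simpa using hk)) with hk' | rfl
    · simp [h k hk', List.getElem_append_left hk']
    · simp

theorem IsPrefixFun.update_length {α : Type*} {t : List α} {f : ℕ → α} (h : IsPrefixFun t f)
    (a : α) : IsPrefixFun (t ++ [a]) (update f t.length a) :=
  isPrefixFun_concat.2 ⟨fun k hk => by rw [update_of_ne hk.ne, h k hk], by simp⟩

theorem mem_Aomega_iff {s : ℕ → List ℕ} (hlen : ∀ n, (s n).length = n) {x : ℕ → ℕ → ℕ} :
    x ∈ Aomega s ↔ ∃ n f, IsPrefixFun (s n) f ∧ ∀ i, x i = update f n i := by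
  constructor
  · rintro ⟨n, γ, h⟩
    refine ⟨n, cat (s n ++ [0]) γ, (isPrefixFun_cat _ _).of_isPrefix (List.prefix_append _ _),
      fun i => ?_⟩
    rw [h i, cat_concat_eq_update _ i 0, hlen]
  · rintro ⟨n, f, hf, h⟩
    refine ⟨n, fun k => f (k + (n + 1)), fun i => ?_⟩
    have hi := hf.update_length i
    rw [hlen] at hi
    rw [h i, ← hi.cat_shift]
    congr 1
    ext k
    have : (s n ++ [i]).length = n + 1 := by simp [hlen]
    rw [this, update_of_ne (by omega)]

theorem isOpen_setOf_isPrefixFun (t : List ℕ) : IsOpen {f : ℕ → ℕ | IsPrefixFun t f} := by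
  have : {f : ℕ → ℕ | IsPrefixFun t f} = ⋂ k : Fin t.length, {f | f k = t.get k} := by
    ext f
    simp only [mem_ofPred_eq, mem_iInter]
    exact ⟨fun h k => h k k.2, fun h k hk => h ⟨k, hk⟩⟩
  rw [this]
  exact isOpen_iInter_of_finite fun k =>
    (isOpen_discrete {t.get k}).preimage (continuous_apply (A := fun _ : ℕ => ℕ) (k : ℕ))

theorem exists_isPrefixFun_subset {U : Set (ℕ → ℕ)} (hU : IsOpen U) (hne : U.Nonempty) :
    ∃ t : List ℕ, {f | IsPrefixFun t f} ⊆ U := by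
  obtain ⟨x, hx⟩ := hne
  obtain ⟨_, ⟨y, n, rfl⟩, -, h⟩ :=
    (PiNat.isTopologicalBasis_cylinders fun _ : ℕ => ℕ).exists_subset_of_mem_open hx hU
  refine ⟨List.ofFn fun i : Fin n => y i, fun f hf => h fun i hi => ?_⟩
  simpa using hf i (by simpa using hi)

theorem continuous_cat (t : List ℕ) : Continuous (cat t : (ℕ → ℕ) → ℕ → ℕ) := by
  refine continuous_pi fun k => ?_
  by_cases hk : k < t.length
  · simpa [cat, hk] using continuous_const
  · simpa [cat, hk] using continuous_apply _

theorem isOpenMap_cat (t : List ℕ) : IsOpenMap (cat t : (ℕ → ℕ) → ℕ → ℕ) := by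
  intro V hV
  have : cat t '' V = {f | IsPrefixFun t f} ∩ (fun f k => f (k + t.length)) ⁻¹' V := by
    ext f
    constructor
    · rintro ⟨γ, hγ, rfl⟩
      refine ⟨isPrefixFun_cat t γ, ?_⟩
      simpa only [mem_preimage, cat_add_length] using hγ
    · rintro ⟨hf, hV⟩
      exact ⟨_, hV, hf.cat_shift⟩
  rw [this]
  exact (isOpen_setOf_isPrefixFun t).inter
    (hV.preimage (continuous_pi fun k => continuous_apply (k + t.length)))

theorem isOpen_setOf_exists_ge_isPrefixFun (s : ℕ → List ℕ) (m : ℕ) :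
    IsOpen {f | ∃ n ≥ m, IsPrefixFun (s n ++ [0]) f} := by
  simp only [ofPred_exists, ofPred_and]
  exact isOpen_iUnion fun n => isOpen_const.inter (isOpen_setOf_isPrefixFun _)

theorem Gset_eq_iInter (s : ℕ → List ℕ) :
    Gset s = ⋂ m, {f | ∃ n ≥ m, IsPrefixFun (s n ++ [0]) f} := by
  simp only [Gset, ofPred_forall]

theorem isGδ_Gset (s : ℕ → List ℕ) : IsGδ (Gset s) := by
  rw [Gset_eq_iInter]
  exact .iInter_of_isOpen (isOpen_setOf_exists_ge_isPrefixFun s)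

theorem Gset_mem_residual {s : ℕ → List ℕ} (hlen : ∀ n, (s n).length = n)
    (hdense : ∀ t : List ℕ, ∃ n, t <+: s n) : Gset s ∈ residual (ℕ → ℕ) := by
  rw [Gset_eq_iInter, countable_iInter_mem]
  refine fun m => residual_of_dense_open (isOpen_setOf_exists_ge_isPrefixFun s m) ?_
  refine dense_iff_inter_open.2 fun U hU hne => ?_
  obtain ⟨t, ht⟩ := exists_isPrefixFun_subset hU hne
  obtain ⟨n, hn⟩ := hdense (t ++ List.replicate m 0)
  have hmn : m ≤ n := by
    have := hn.length_le
    simp only [List.length_append, List.length_replicate, hlen] at this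
    omega
  have h := isPrefixFun_cat (s n ++ [0]) 0
  exact ⟨_, ht (h.of_isPrefix ((List.prefix_append _ _).trans
    (hn.trans (List.prefix_append _ _)))), n, hmn, h⟩

/-- Baire category: a countable Borel colouring of `Gset s` has a monochromatic hyperedge. -/
theorem exists_monochromatic_Aomega {s : ℕ → List ℕ} (hlen : ∀ n, (s n).length = n)
    (hdense : ∀ t : List ℕ, ∃ n, t <+: s n) {c : ↥(Gset s) → ℕ}
    (hc : @Measurable _ _ (borel ↥(Gset s)) ⊤ c) :
    ∃ γ : ℕ → ↥(Gset s), (fun i => (γ i : ℕ → ℕ)) ∈ Aomega s ∧ ∀ i j, c (γ i) = c (γ j) := by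
  borelize (ℕ → ℕ)
  have hborel : (borel ↥(Gset s)) = Subtype.instMeasurableSpace := BorelSpace.measurable_eq.symm
  rw [hborel] at hc
  let C : ℕ → Set (ℕ → ℕ) := fun k => Subtype.val '' (c ⁻¹' {k})
  have hC : ∀ k, MeasurableSet (C k) := fun k =>
    (isGδ_Gset s).measurableSet.subtype_image (hc trivial)
  choose U hUo hCU using fun k => (hC k).residualEq_isOpen
  have hall : ∀ᶠ f in residual (ℕ → ℕ), f ∈ Gset s ∧ ∀ k, f ∈ C k ↔ f ∈ U k :=
    Eventually.and (Gset_mem_residual hlen hdense) (eventually_countable_forall.2 fun k => eventuallyEq_set.1 (hCU k))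
  obtain ⟨f, hfG, hf⟩ := (dense_of_mem_residual hall).nonempty
  obtain ⟨t, ht⟩ := exists_isPrefixFun_subset (hUo (c ⟨f, hfG⟩))
    ⟨f, (hf _).1 ⟨⟨f, hfG⟩, rfl, rfl⟩⟩
  obtain ⟨n, hn⟩ := hdense t
  have hγ : ∀ᶠ γ in residual (ℕ → ℕ), ∀ i : ℕ, cat (s n ++ [i]) γ ∈ C (c ⟨f, hfG⟩) := by
    refine eventually_countable_forall.2 fun i => ?_
    filter_upwards [(tendsto_residual_of_isOpenMap (continuous_cat (s n ++ [i]))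
      (isOpenMap_cat _)).eventually hall] with γ hγ
    exact (hγ.2 _).2 (ht ((isPrefixFun_cat _ γ).of_isPrefix
      (hn.trans (List.prefix_append _ _))))
  obtain ⟨γ, hγ⟩ := (dense_of_mem_residual hγ).nonempty
  choose x hx hxγ using hγ
  exact ⟨x, ⟨n, γ, hxγ⟩, fun i j => (hx i).trans (hx j).symm⟩

theorem tendsto_update_atTop {α : Type*} [TopologicalSpace α] (f : ℕ → α) (a : α) :
    Tendsto (fun n => update f n a) atTop (𝓝 f) := by
  refine tendsto_pi_nhds.2 fun k => tendsto_const_nhds.congr' ?_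
  filter_upwards [eventually_gt_atTop k] with n hn
  rw [update_of_ne hn.ne]

theorem exists_forall_of_eventually_nhds_zero {P : (ℕ → ℕ) → Prop} (h : ∀ᶠ f in 𝓝 0, P f) :
    ∃ N, ∀ f : ℕ → ℕ, (∀ k < N, f k = 0) → P f := by
  obtain ⟨V, hV, hVo, h0⟩ := eventually_nhds_iff.1 h
  obtain ⟨_, ⟨y, n, rfl⟩, h0, h⟩ :=
    (PiNat.isTopologicalBasis_cylinders fun _ : ℕ => ℕ).exists_subset_of_mem_open h0 hVo
  exact ⟨n, fun f hf => hV f (h fun i hi => (hf i hi).trans (h0 i hi))⟩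

/-- A continuous homomorphism acts near `0` as a fixed coordinate change. -/
theorem exists_forall_map_update {s : ℕ → List ℕ} (hlen : ∀ n, (s n).length = n)
    {u : (ℕ → ℕ) → ℕ → ℕ} (hu : Continuous u)
    (hA : ∀ γ ∈ Aomega s, (fun i => u (γ i)) ∈ Aomega s) {n : ℕ}
    (hn : s n = List.replicate n 0) :
    ∃ p N, n < N ∧ ∀ f : ℕ → ℕ, (∀ k < N, f k = 0) → ∀ i, u (update f n i) = update (u f) p i := by
  have key : ∀ f : ℕ → ℕ, (∀ k < n + 1, f k = 0) →
      ∃ p, u f p = 0 ∧ ∀ i, u (update f n i) = update (u f) p i := by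
    intro f hf
    obtain ⟨p, g, -, hg⟩ := (mem_Aomega_iff hlen).1 (hA (fun i => update f n i)
      ((mem_Aomega_iff hlen).2 ⟨n, f, fun k hk => by
        have hkn : k < n := by rwa [hlen] at hk
        simp [hf k (by omega), hn], fun i => rfl⟩))
    have h0 : u f = update g p 0 := by
      rw [← hg 0, update_eq_self_iff.2 (hf n n.lt_succ_self).symm]
    exact ⟨p, by simp [h0], fun i => by rw [h0, update_idem]; exact hg i⟩
  obtain ⟨p, hp0, hp⟩ := key 0 (by simp)
  have hev : ∀ᶠ f in 𝓝 (0 : ℕ → ℕ), u f p = 0 ∧ u (update f n 1) p = 1 := by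
    have hv : Continuous fun f : ℕ → ℕ => u (update f n 1) :=
      hu.comp (continuous_id.update n continuous_const)
    have h0 := tendsto_pi_nhds.1 (hu.tendsto 0) p
    have h1 := tendsto_pi_nhds.1 (hv.tendsto 0) p
    rw [nhds_discrete ℕ, tendsto_pure] at h0 h1
    simp only [hp0, hp 1, update_self] at h0 h1
    exact h0.and h1
  obtain ⟨N, hN⟩ := exists_forall_of_eventually_nhds_zero hev
  refine ⟨p, max N (n + 1), by omega, fun f hf i => ?_⟩
  obtain ⟨q, -, hq⟩ := key f fun k hk => hf k (by omega)
  obtain ⟨h0, h1⟩ := hN f fun k hk => hf k (by omega)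
  obtain rfl : p = q := by
    by_contra hpq
    rw [hq, update_of_ne hpq, h0] at h1
    exact zero_ne_one h1
  exact hq i

/-- A map which acts as the change of coordinate `q j` when coordinate `a j` of a point vanishing below
`N j` is changed takes arbitrary prescribed values at the coordinates `q j`. -/
theorem exists_forall_apply_eq {u : (ℕ → ℕ) → ℕ → ℕ} {a q N : ℕ → ℕ}
    (hu : ∀ j, ∀ f : ℕ → ℕ, (∀ k < N j, f k = 0) →
      ∀ i, u (update f (a j) i) = update (u f) (q j) i)
    (ha : ∀ j, a j < N j) (hN : ∀ j, N j ≤ a (j + 1)) (hq : StrictMono q) (v : ℕ → ℕ) :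
    ∃ f, ∀ j, u f (q j) = v j := by
  have hmono : StrictMono a := strictMono_nat_of_lt_succ fun j => (ha j).trans_le (hN j)
  let f : ℕ → ℕ → ℕ := fun j k => if a j ≤ k then extend a v 0 k else 0
  have hf : ∀ j, f j = update (f (j + 1)) (a j) (v j) := by
    intro j
    ext k
    rcases lt_trichotomy k (a j) with hk | rfl | hk
    · have := hmono (Nat.lt_add_one j)
      rw [update_of_ne hk.ne]
      simp only [f, if_neg (show ¬ a j ≤ k by omega), if_neg (show ¬ a (j + 1) ≤ k by omega)]
    · simp [f, hmono.injective.extend_apply]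
    · rw [update_of_ne hk.ne']
      simp only [f, if_pos hk.le]
      split_ifs with h
      · rfl
      · rw [extend_apply', Pi.zero_apply]
        rintro ⟨l, rfl⟩
        have h1 := hmono.lt_iff_lt.1 hk
        have h2 := hmono.lt_iff_lt.1 (not_le.1 h)
        omega
  have huf : ∀ j, u (f j) = update (u (f (j + 1))) (q j) (v j) := by
    intro j
    conv_lhs => rw [hf j]
    exact hu j _ (fun k hk => if_neg (by have := hN j; omega)) _
  refine ⟨f 0, fun j => ?_⟩
  have hle : ∀ l ≤ j, u (f 0) (q j) = u (f l) (q j) := by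
    intro l
    induction l with
    | zero => simp
    | succ l ih =>
      intro hl
      rw [ih (by omega), huf l, update_of_ne (hq (show l < j by omega)).ne']
  rw [hle j le_rfl, huf j, update_self]

theorem exists_notMem_Gset {s : ℕ → List ℕ} (hlen : ∀ n, (s n).length = n)
    (hzero : ∀ m, ∃ n ≥ m, s n = List.replicate n 0)
    {u : (ℕ → ℕ) → ℕ → ℕ} (hu : Continuous u)
    (hA : ∀ γ ∈ Aomega s, (fun i => u (γ i)) ∈ Aomega s) : ∃ f, u f ∉ Gset s := by
  have hloc : ∀ n, ∃ p N, s n = List.replicate n 0 → n < N ∧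
      ∀ f : ℕ → ℕ, (∀ k < N, f k = 0) → ∀ i, u (update f n i) = update (u f) p i := by
    intro n
    by_cases hn : s n = List.replicate n 0
    · obtain ⟨p, N, h⟩ := exists_forall_map_update hlen hu hA hn
      exact ⟨p, N, fun _ => h⟩
    · exact ⟨0, 0, fun h => absurd h hn⟩
  choose p N hpN using hloc
  have hnext : ∀ M, ∃ n, s n = List.replicate n 0 ∧ N M ≤ n ∧ p M < p n := by
    intro M
    have hlim : Tendsto (fun n => u (update 0 n 1)) atTop (𝓝 (u 0)) :=
      (hu.tendsto 0).comp (tendsto_update_atTop (0 : ℕ → ℕ) 1)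
    have hev : ∀ᶠ n in atTop, ∀ k ∈ Finset.range (p M + 1), u (update 0 n 1) k = u 0 k := by
      refine (Finset.eventually_all _).2 fun k _ => ?_
      have := tendsto_pi_nhds.1 hlim k
      rwa [nhds_discrete, tendsto_pure] at this
    obtain ⟨n₀, hn₀⟩ := eventually_atTop.1 hev
    obtain ⟨n, hn, hs⟩ := hzero (max n₀ (N M))
    refine ⟨n, hs, by omega, ?_⟩
    by_contra! hle
    have h1 := hn₀ n (by omega) (p n) (Finset.mem_range.2 (by omega))
    have h0 := congrFun ((hpN n hs).2 0 (by simp) 0) (p n)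
    rw [(hpN n hs).2 0 (by simp), update_self] at h1
    rw [update_self, update_eq_self_iff.2 (Pi.zero_apply n).symm] at h0
    omega
  choose next hnext hNext hpnext using hnext
  let a : ℕ → ℕ := fun j => next^[j + 1] 0
  have hsucc : ∀ j, a (j + 1) = next (a j) := fun j => iterate_succ_apply' next (j + 1) 0
  have hs : ∀ j, s (a j) = List.replicate (a j) 0 := fun j => by
    simp only [a, iterate_succ_apply']
    exact hnext _
  have hp : StrictMono fun j => p (a j) :=
    strictMono_nat_of_lt_succ fun j => by simpa only [hsucc] using hpnext (a j)
  obtain ⟨f, hf⟩ := exists_forall_apply_eq (u := u) (a := a) (q := fun j => p (a j))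
    (N := fun j => N (a j)) (fun j => (hpN _ (hs j)).2) (fun j => (hpN _ (hs j)).1)
    (fun j => by simpa only [hsucc] using hNext (a j)) hp
    (fun j => (Finset.range (p (a (j + 1)))).sup (fun m => (s m ++ [0]).getD (p (a j)) 0) + 1)
  refine ⟨f, fun hG => ?_⟩
  obtain ⟨m, hm, hpre⟩ := hG (p (a 0))
  obtain ⟨j, hj, hj'⟩ : ∃ j, p (a j) ≤ m ∧ m < p (a (j + 1)) := by
    have hex : ∃ j, m < p (a (j + 1)) := ⟨m, (Nat.lt_succ_self m).trans_le (hp.le_apply)⟩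
    refine ⟨Nat.find hex, ?_, Nat.find_spec hex⟩
    rcases h : Nat.find hex with _ | j
    · exact hm
    · exact not_lt.1 (Nat.find_min hex (h ▸ j.lt_succ_self))
  have hlt : p (a j) < (s m ++ [0]).length := by simp [hlen]; omega
  have h1 := hpre _ hlt
  have h2 := Finset.le_sup (f := fun m => (s m ++ [0]).getD (p (a j)) 0) (Finset.mem_range.2 hj')
  rw [hf j] at h1
  simp only [List.getD_eq_getElem _ _ hlt] at h2
  simp only [List.get_eq_getElem] at h1
  omega

theorem stmt3 (s : ℕ → List ℕ)
    (hlen : ∀ n, (s n).length = n)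
    (hdense : ∀ t : List ℕ, ∃ n, t <+: s n)
    (hzero : ∀ m, ∃ n ≥ m, s n = List.replicate n 0) :
    (¬ ∃ c : ↥(Gset s) → ℕ, @Measurable _ _ (borel ↥(Gset s)) ⊤ c ∧
        ∀ γ : ℕ → ↥(Gset s), (fun i => (γ i : ℕ → ℕ)) ∈ Aomega s →
          ¬ ∀ i j, c (γ i) = c (γ j)) ∧
    (¬ ∃ u : (ℕ → ℕ) → ↥(Gset s), Continuous u ∧
        ∀ γ ∈ Aomega s, (fun i => (u (γ i) : ℕ → ℕ)) ∈ Aomega s) := by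
  constructor
  · rintro ⟨c, hc, h⟩
    obtain ⟨γ, hγ, hcγ⟩ := exists_monochromatic_Aomega hlen hdense hc
    exact h γ hγ hcγ
  · rintro ⟨u, hu, hA⟩
    obtain ⟨f, hf⟩ := exists_notMem_Gset hlen hzero (continuous_subtype_val.comp hu) hA
    exact hf (u f).2
end

section
/- Let d ≥ 2 be an integer and let G be a dense G_δ subset of d^ω. Then there is no Baire-measurable map u : G → ℕ (G with the subspace topology) such that for every tuple (γ_i)_{i<d} ∈ 𝔸_d with γ_i ∈ G for every i < d, the values u(γ_i) are not all equal. (In the paper's notation: [G, 𝔸_d ∩ G^d] ⋠_Bm [ω, ¬Δ^d(ω)].) -/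
open Set

/-- The set `𝔸_d ⊆ (d^ω)^d` associated with the dense sequence `s` in `d^{<ω}`. -/
def Ad (d : ℕ) (s : ℕ → List (Fin d)) : Set (Fin d → ℕ → Fin d) :=
  {x | ∃ n γ, ∀ i, x i = cat (s n ++ [i]) γ}

/-- A set has the Baire property if it differs from an open set by a meager set. -/
def HasBaireProperty {α : Type*} [TopologicalSpace α] (S : Set α) : Prop :=
  ∃ U : Set α, IsOpen U ∧ IsMeagre (symmDiff S U)

/-- A map is Baire-measurable if preimages of open sets have the Baire property. -/
def BaireMeasurableFun {α β : Type*} [TopologicalSpace α] [TopologicalSpace β]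
    (f : α → β) : Prop :=
  ∀ U : Set β, IsOpen U → HasBaireProperty (f ⁻¹' U)

theorem cat_of_lt {α : Type*} (s : List α) (γ : ℕ → α) {k : ℕ} (h : k < s.length) :
    cat s γ k = s[k] := by
  simp [cat, h]

theorem cat_length_add {α : Type*} (s : List α) (γ : ℕ → α) (k : ℕ) :
    cat s γ (s.length + k) = γ k := by
  simp [cat]

theorem continuous_cat_s8 {α : Type*} [TopologicalSpace α] (s : List α) :
    Continuous (cat s) := by
  refine continuous_pi fun k => ?_
  by_cases h : k < s.length
  · simpa only [cat, h, dite_true] using continuous_const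
  · simpa only [cat, h, dite_false] using continuous_apply (k - s.length)

/-- Prepending a finite sequence `s` maps `U` onto the set of the sequences that start with `s`
and whose remaining part belongs to `U`. -/
theorem image_cat {α : Type*} (s : List α) (U : Set (ℕ → α)) :
    cat s '' U =
      (⋂ k : Fin s.length, (fun y : ℕ → α => y k) ⁻¹' {s[k]}) ∩
        (fun y k => y (s.length + k)) ⁻¹' U := by
  ext y
  simp only [mem_inter_iff, mem_iInter, mem_preimage, mem_singleton_iff]
  constructor
  · rintro ⟨γ, hγ, rfl⟩
    refine ⟨fun k => cat_of_lt s γ k.2, ?_⟩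
    simpa only [cat_length_add] using hγ
  · rintro ⟨hs, hU⟩
    refine ⟨_, hU, funext fun k => ?_⟩
    by_cases h : k < s.length
    · rw [cat_of_lt _ _ h]
      exact (hs ⟨k, h⟩).symm
    · obtain ⟨j, rfl⟩ := Nat.exists_eq_add_of_le (not_lt.1 h)
      rw [cat_length_add]

theorem isOpenMap_cat_s8 {α : Type*} [TopologicalSpace α] [DiscreteTopology α] (s : List α) :
    IsOpenMap (cat s) := by
  intro U hU
  rw [image_cat]
  refine (isOpen_iInter_of_finite fun k => ?_).inter (hU.preimage ?_)
  · exact (isOpen_discrete _).preimage (continuous_apply _)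
  · exact continuous_pi fun k => continuous_apply _

/-- Every nonempty open set of sequences contains all the sequences extending some finite one. -/
theorem exists_list_forall_cat_mem {α : Type*} [TopologicalSpace α] [DiscreteTopology α]
    {V : Set (ℕ → α)} (hV : IsOpen V) (hne : V.Nonempty) :
    ∃ t : List α, ∀ l, t <+: l → ∀ γ, cat l γ ∈ V := by
  obtain ⟨x, hx⟩ := hne
  obtain ⟨_, ⟨y, n, rfl⟩, hxn, hnV⟩ :=
    (PiNat.isTopologicalBasis_cylinders fun _ : ℕ => α).exists_subset_of_mem_open hx hV
  refine ⟨List.ofFn fun i : Fin n => y i, fun l hl γ => hnV fun i hi => ?_⟩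
  have hi' : i < (List.ofFn fun i : Fin n => y i).length := by simpa using hi
  rw [cat_of_lt l γ (hi'.trans_le hl.length_le), ← hl.getElem hi', List.getElem_ofFn]

/-- A Baire-measurable map from a comeagre subspace to a countable discrete space has, on a
comeagre set, fibers that are traces of open sets. -/
theorem BaireMeasurableFun.exists_residual {X β : Type*} [TopologicalSpace X]
    [TopologicalSpace β] [DiscreteTopology β] [Countable β] {G : Set X}
    (hG : G ∈ residual X) {u : G → β} (hu : BaireMeasurableFun u) :
    ∃ C ∈ residual X, ∃ V : β → Set X, (∀ b, IsOpen (V b)) ∧ C ⊆ G ∧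
      ∀ x : G, (x : X) ∈ C → ∀ b, u x = b ↔ (x : X) ∈ V b := by
  choose U hU hM using fun b => hu {b} (isOpen_discrete _)
  choose V hV hVU using fun b => isOpen_induced_iff.1 (hU b)
  have hmeagre := isMeagre_iUnion fun b => (hM b).image_val
  refine ⟨_, Filter.inter_mem hG hmeagre, V, hV, inter_subset_left, fun x hx b => ?_⟩
  have hxb : x ∉ symmDiff (u ⁻¹' {b}) (U b) := fun h =>
    hx.2 (mem_iUnion.2 ⟨b, mem_image_of_mem _ h⟩)
  have hxU : x ∈ U b ↔ (x : X) ∈ V b := by rw [← hVU b]; rfl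
  rw [← hxU]
  rw [mem_symmDiff] at hxb
  simp only [mem_preimage, mem_singleton_iff] at hxb
  tauto

theorem stmt8 (d : ℕ) (hd : 2 ≤ d) (s : ℕ → List (Fin d))
    (hlen : ∀ n, (s n).length = n)
    (hdense : ∀ t : List (Fin d), ∃ n, t <+: s n)
    (G : Set (ℕ → Fin d)) (hGdense : Dense G) (hGδ : IsGδ G) :
    ¬ ∃ u : ↥G → ℕ, BaireMeasurableFun u ∧
        ∀ γ : Fin d → ↥G, (fun i => (γ i : ℕ → Fin d)) ∈ Ad d s →
          ¬ ∀ i j, u (γ i) = u (γ j) := by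
  rintro ⟨u, hu, h⟩
  have : Nonempty (Fin d) := ⟨⟨0, by omega⟩⟩
  obtain ⟨C, hC, V, hV, hCG, hCV⟩ := hu.exists_residual (residual_of_dense_Gδ hGδ hGdense)
  obtain ⟨x, hx⟩ := (dense_of_mem_residual hC).nonempty
  obtain ⟨t, ht⟩ := exists_list_forall_cat_mem (hV (u ⟨x, hCG hx⟩))
    ⟨x, (hCV ⟨x, hCG hx⟩ hx _).1 rfl⟩
  obtain ⟨n, hn⟩ := hdense t
  have hpre : ∀ i, cat (s n ++ [i]) ⁻¹' C ∈ residual (ℕ → Fin d) := fun i => by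
    have hmeagre : IsMeagre Cᶜ := by rwa [IsMeagre, compl_compl]
    simpa [IsMeagre] using
      hmeagre.preimage_of_isOpenMap (continuous_cat_s8 (s n ++ [i])) (isOpenMap_cat_s8 _)
  obtain ⟨γ, hγ⟩ := (dense_of_mem_residual (Filter.iInter_mem.2 hpre)).nonempty
  rw [mem_iInter] at hγ
  have hval : ∀ i, u ⟨_, hCG (hγ i)⟩ = u ⟨x, hCG hx⟩ := fun i =>
    (hCV ⟨_, hCG (hγ i)⟩ (hγ i) _).2 (ht _ (hn.trans (List.prefix_append _ _)) γ)
  exact h (fun i => ⟨_, hCG (hγ i)⟩) ⟨n, γ, fun _ => rfl⟩ fun i j => (hval i).trans (hval j).symm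
end
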